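/- (Filling theorem) Let S be a cancellative semigroup and let ε be a real number with 0 < ε ≤ 1/2. Then there exists an integer n₀ = n₀(ε) ≥ 1 such that for each integer n ≥ n₀ the following holds: if (K_j)_{1≤j≤n} is a finite sequence of nonempty finite subsets of S such that α(K_k, K_j) ≤ ε^{2n}/|K_j| for all 1 ≤ j < k ≤ n, and D is a nonempty finite subset of S such that α(D, K_j) ≤ ε^{2n} for all 1 ≤ j ≤ n, then there exists a finite sequence (P_j)_{1≤j≤n} of finite subsets of S satisfying: (T1) P_j is an (ε, K_j)-filling pattern for D for every 1 ≤ j ≤ n; (T2) the subsets K_jP_j ⊆ D, 1 ≤ j ≤ n, are pairwise disjoint; (T3) the subset D' := D \ ⋃_{1≤j≤n} K_jP_j satisfies |D'| ≤ ε|D|. -/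

import Mathlib

/-- A family `(A j)_{j ∈ J}` of finite subsets of `X` is `ε`-disjoint if there is a family
`(B j)_{j ∈ J}` of pairwise disjoint subsets of `X` with `B j ⊆ A j` and
`|B j| ≥ (1 - ε) |A j|` for all `j`. -/
def EpsDisjoint {X : Type*} (ε : ℝ) {J : Type*} (A : J → Finset X) : Prop :=
  ∃ B : J → Finset X,
    Pairwise (fun i j => Disjoint (B i) (B j)) ∧
    ∀ j, B j ⊆ A j ∧ (1 - ε) * ((A j).card : ℝ) ≤ ((B j).card : ℝ)

/-- The right `K`-interior of a finite subset `Ω` of a semigroup: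
`int_K(Ω) = {s ∈ Ω : Ks ⊆ Ω}`. -/
def finInterior {S : Type*} [Mul S] [DecidableEq S] (K Ω : Finset S) : Finset S :=
  Ω.filter fun s => ∀ k ∈ K, k * s ∈ Ω

/-- The right `K`-boundary of a finite subset `A` of a semigroup:
`∂_K(A) = A \ int_K(A) = {s ∈ A : ¬(Ks ⊆ A)}`. -/
def finBoundary {S : Type*} [Mul S] [DecidableEq S] (K A : Finset S) : Finset S :=
  A.filter fun s => ¬ ∀ k ∈ K, k * s ∈ A

/-- The amenability constant of `A` with respect to `K`: `α(A, K) = |∂_K(A)| / |A|`. -/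
noncomputable def amenConst {S : Type*} [Mul S] [DecidableEq S] (A K : Finset S) : ℝ :=
  ((finBoundary K A).card : ℝ) / (A.card : ℝ)

/-- A finite subset `P ⊆ S` is an `(ε, K)`-filling pattern for `Ω` if `P ⊆ int_K(Ω)` and
the family `(Ks)_{s ∈ P}` is `ε`-disjoint. -/
def IsFillingPattern {S : Type*} [Mul S] [DecidableEq S]
    (ε : ℝ) (K Ω P : Finset S) : Prop :=
  P ⊆ finInterior K Ω ∧ EpsDisjoint ε (fun s : { x // x ∈ P } => K.image (· * s.val))

section Filling

open Finset

variable {S : Type*} [Semigroup S] [DecidableEq S]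

/-- The union `KP` of the right translates `Ks`, `s ∈ P`. -/
abbrev translates (K P : Finset S) : Finset S :=
  P.biUnion fun s => K.image (· * s)

theorem card_image_mul_right [IsCancelMul S] (K : Finset S) (s : S) :
    (K.image (· * s)).card = K.card :=
  card_image_of_injective _ (mul_left_injective s)

theorem card_finInterior_add_card_finBoundary (K A : Finset S) :
    (finInterior K A).card + (finBoundary K A).card = A.card :=
  card_filter_add_card_filter_not _

theorem finBoundary_image_mul_right_subset (K A : Finset S) (s : S) :
    finBoundary K (A.image (· * s)) ⊆ (finBoundary K A).image (· * s) := by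
  intro x hx
  simp only [finBoundary, mem_filter, mem_image] at hx ⊢
  obtain ⟨⟨a, ha, rfl⟩, hx⟩ := hx
  exact ⟨a, ⟨ha, fun h => hx fun k hk => ⟨k * a, h k hk, mul_assoc k a s⟩⟩, rfl⟩

theorem card_finBoundary_image_mul_right_le (K A : Finset S) (s : S) :
    (finBoundary K (A.image (· * s))).card ≤ (finBoundary K A).card :=
  (card_le_card (finBoundary_image_mul_right_subset K A s)).trans card_image_le

theorem finBoundary_biUnion_subset {ι : Type*} (K : Finset S) (I : Finset ι)
    (A : ι → Finset S) :
    finBoundary K (I.biUnion A) ⊆ I.biUnion fun i => finBoundary K (A i) := by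
  intro x hx
  simp only [finBoundary, mem_filter, mem_biUnion] at hx ⊢
  obtain ⟨⟨i, hi, hxi⟩, hx⟩ := hx
  exact ⟨i, hi, hxi, fun h => hx fun k hk => ⟨i, hi, h k hk⟩⟩

theorem card_finBoundary_biUnion_le {ι : Type*} (K : Finset S) (I : Finset ι)
    (A : ι → Finset S) :
    (finBoundary K (I.biUnion A)).card ≤ ∑ i ∈ I, (finBoundary K (A i)).card :=
  (card_le_card (finBoundary_biUnion_subset K I A)).trans card_biUnion_le

theorem card_filter_mul_mem_le_card_finBoundary [IsCancelMul S] {K Ω A : Finset S} {k : S}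
    (hk : k ∈ K) :
    ((Ω \ A).filter fun x => k * x ∈ A).card ≤ (finBoundary K A).card := by
  have hinj : Function.Injective (k * ·) := mul_right_injective k
  calc ((Ω \ A).filter fun x => k * x ∈ A).card
      = (((Ω \ A).filter fun x => k * x ∈ A).image (k * ·)).card :=
        (card_image_of_injective _ hinj).symm
    _ ≤ (A \ A.image (k * ·)).card := by
        refine card_le_card fun y hy => ?_
        simp only [mem_image, mem_filter, mem_sdiff] at hy ⊢
        obtain ⟨x, ⟨⟨-, hxA⟩, hkx⟩, rfl⟩ := hy
        refine ⟨hkx, ?_⟩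
        rintro ⟨a, ha, h⟩
        exact hxA (hinj h ▸ ha)
    _ = (A.image (k * ·) \ A).card :=
        card_sdiff_comm (card_image_of_injective _ hinj).symm
    _ ≤ ((finBoundary K A).image (k * ·)).card := by
        refine card_le_card fun y hy => ?_
        simp only [mem_image, finBoundary, mem_filter, mem_sdiff] at hy ⊢
        obtain ⟨⟨a, ha, rfl⟩, hka⟩ := hy
        exact ⟨a, ⟨ha, fun h => hka (h k hk)⟩, rfl⟩
    _ ≤ (finBoundary K A).card := card_image_le

theorem card_finBoundary_sdiff_le [IsCancelMul S] (K Ω A : Finset S) :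
    (finBoundary K (Ω \ A)).card ≤
      (finBoundary K Ω).card + K.card * (finBoundary K A).card := by
  have hsub : finBoundary K (Ω \ A) ⊆
      finBoundary K Ω ∪ K.biUnion fun k => (Ω \ A).filter fun x => k * x ∈ A := by
    intro x hx
    simp only [finBoundary, mem_filter, mem_union, mem_biUnion, mem_sdiff] at hx ⊢
    obtain ⟨⟨hxΩ, hxA⟩, hx⟩ := hx
    by_cases h : ∀ k ∈ K, k * x ∈ Ω
    · push Not at hx
      obtain ⟨k, hk, hkx⟩ := hx
      exact Or.inr ⟨k, hk, ⟨hxΩ, hxA⟩, hkx (h k hk)⟩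
    · exact Or.inl ⟨hxΩ, h⟩
  refine (card_le_card hsub).trans ((card_union_le _ _).trans (Nat.add_le_add_left ?_ _))
  exact card_biUnion_le_card_mul _ _ _ fun k hk => card_filter_mul_mem_le_card_finBoundary hk

theorem isFillingPattern_iff {ε : ℝ} {K Ω P : Finset S} :
    IsFillingPattern ε K Ω P ↔ P ⊆ finInterior K Ω ∧ ∃ B : S → Finset S,
      (P : Set S).PairwiseDisjoint B ∧
      ∀ s ∈ P, B s ⊆ K.image (· * s) ∧
        (1 - ε) * ((K.image (· * s)).card : ℝ) ≤ ((B s).card : ℝ) := by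
  refine and_congr_right fun _ => ⟨?_, ?_⟩
  · rintro ⟨B, hd, hB⟩
    refine ⟨fun s => if h : s ∈ P then B ⟨s, h⟩ else ∅, ?_, ?_⟩
    · intro s hs t ht hst
      rw [mem_coe] at hs ht
      simp only [Function.onFun, dif_pos hs, dif_pos ht]
      exact hd fun h => hst (congrArg Subtype.val h)
    · intro s hs
      simpa only [dif_pos hs] using hB ⟨s, hs⟩
  · rintro ⟨B, hd, hB⟩
    exact ⟨fun s => B s.1, fun s t hst => hd s.2 t.2 fun h => hst (Subtype.ext h),
      fun s => hB s.1 s.2⟩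

theorem isFillingPattern_empty (ε : ℝ) (K Ω : Finset S) : IsFillingPattern ε K Ω ∅ :=
  isFillingPattern_iff.2 ⟨empty_subset _, fun _ => ∅, by simp, by simp⟩

theorem IsFillingPattern.mono {ε : ℝ} {K Ω Ω' P : Finset S} (h : IsFillingPattern ε K Ω P)
    (hΩ : Ω ⊆ Ω') : IsFillingPattern ε K Ω' P := by
  refine ⟨fun s hs => ?_, h.2⟩
  have hs' := h.1 hs
  simp only [finInterior, mem_filter] at hs' ⊢
  exact ⟨hΩ hs'.1, fun k hk => hΩ (hs'.2 k hk)⟩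

theorem IsFillingPattern.translates_subset {ε : ℝ} {K Ω P : Finset S}
    (h : IsFillingPattern ε K Ω P) : translates K P ⊆ Ω := by
  refine biUnion_subset.2 fun s hs => image_subset_iff.2 fun k hk => ?_
  exact (mem_filter.1 (h.1 hs)).2 k hk

theorem IsFillingPattern.card_mul_card_le [IsCancelMul S] {ε : ℝ} {K Ω P : Finset S}
    (h : IsFillingPattern ε K Ω P) :
    (1 - ε) * ((P.card : ℝ) * K.card) ≤ (translates K P).card := by
  obtain ⟨-, B, hd, hB⟩ := isFillingPattern_iff.1 h
  calc (1 - ε) * ((P.card : ℝ) * K.card) = ∑ _s ∈ P, (1 - ε) * (K.card : ℝ) := by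
        rw [sum_const, nsmul_eq_mul]; ring
    _ ≤ ∑ s ∈ P, ((B s).card : ℝ) :=
        sum_le_sum fun s hs => by simpa only [card_image_mul_right] using (hB s hs).2
    _ = ((P.biUnion B).card : ℝ) := by rw [card_biUnion hd, Nat.cast_sum]
    _ ≤ (translates K P).card := by
        exact_mod_cast card_le_card (biUnion_mono fun s hs => (hB s hs).1)

theorem IsFillingPattern.insert {ε : ℝ} {K Ω P : Finset S} {s : S}
    (h : IsFillingPattern ε K Ω P) (hsΩ : s ∈ finInterior K Ω) (hsP : s ∉ P)
    (hs : (1 - ε) * ((K.image (· * s)).card : ℝ) ≤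
      ((K.image (· * s) \ translates K P).card : ℝ)) :
    IsFillingPattern ε K Ω (insert s P) := by
  obtain ⟨hP, B, hd, hB⟩ := isFillingPattern_iff.1 h
  have hne : ∀ t ∈ P, t ≠ s := fun t ht hts => hsP (hts ▸ ht)
  refine isFillingPattern_iff.2 ⟨insert_subset hsΩ hP,
    Function.update B s (K.image (· * s) \ translates K P), ?_, ?_⟩
  · rw [coe_insert, Set.pairwiseDisjoint_insert]
    refine ⟨fun t ht u hu htu => ?_, fun t ht _ => ?_⟩
    · simp only [Function.onFun, Function.update_of_ne (hne t ht),
        Function.update_of_ne (hne u hu)]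
      exact hd ht hu htu
    · rw [Function.update_self, Function.update_of_ne (hne t ht)]
      exact disjoint_of_subset_right ((hB t ht).1.trans
        (subset_biUnion_of_mem (fun s => K.image (· * s)) ht)) sdiff_disjoint
  · intro t ht
    obtain rfl | ht := mem_insert.1 ht
    · rw [Function.update_self]
      exact ⟨sdiff_subset, hs⟩
    · rw [Function.update_of_ne (hne t ht)]
      exact hB t ht

theorem sum_card_image_mul_right_inter_le [IsCancelMul S] (K I U : Finset S) :
    ∑ s ∈ I, (K.image (· * s) ∩ U).card ≤ U.card * K.card := by
  calc ∑ s ∈ I, (K.image (· * s) ∩ U).card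
      = ∑ s ∈ I, ∑ y ∈ U, if y ∈ K.image (· * s) then 1 else 0 := by
        refine sum_congr rfl fun s _ => ?_
        rw [inter_comm, ← filter_mem_eq_inter, card_filter]
    _ = ∑ y ∈ U, (I.filter fun s => y ∈ K.image (· * s)).card := by
        rw [sum_comm]
        exact sum_congr rfl fun y _ => (card_filter _ _).symm
    _ ≤ U.card * K.card := by
        refine sum_le_card_nsmul _ _ _ fun y _ => ?_
        have hex : ∀ s ∈ I.filter (fun s => y ∈ K.image (· * s)), ∃ k ∈ K, k * s = y :=
          fun s hs => mem_image.1 (mem_filter.1 hs).2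
        choose! f hf hfy using hex
        refine card_le_card_of_injOn f hf fun s hs t ht hst => ?_
        have h := (hfy s hs).trans (hfy t ht).symm
        rw [← hst] at h
        exact mul_left_cancel h

/-- Every finite set contains a filling pattern covering a proportion `ε` of its interior. -/
theorem exists_isFillingPattern [IsCancelMul S] {ε : ℝ} (hε₁ : ε ≤ 1) {K : Finset S}
    (hK : K.Nonempty) (Ω : Finset S) :
    ∃ P, IsFillingPattern ε K Ω P ∧
      ε * ((finInterior K Ω).card : ℝ) ≤ (translates K P).card := by
  classical
  obtain ⟨P, hPmem, hPmax⟩ := exists_max_image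
    ((finInterior K Ω).powerset.filter fun P => IsFillingPattern ε K Ω P) card
    ⟨∅, mem_filter.2 ⟨empty_mem_powerset _, isFillingPattern_empty ε K Ω⟩⟩
  have hP := (mem_filter.1 hPmem).2
  refine ⟨P, hP, ?_⟩
  have hlarge : ∀ s ∈ finInterior K Ω,
      ε * (K.card : ℝ) ≤ ((K.image (· * s) ∩ translates K P).card : ℝ) := by
    intro s hs
    by_cases hsP : s ∈ P
    · rw [inter_eq_left.2 (subset_biUnion_of_mem (fun s => K.image (· * s)) hsP),
        card_image_mul_right]
      exact mul_le_of_le_one_left (Nat.cast_nonneg _) hε₁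
    · by_contra! hlt
      have hsplit : ((K.image (· * s) \ translates K P).card : ℝ) +
          ((K.image (· * s) ∩ translates K P).card : ℝ) = (K.card : ℝ) := by
        rw [← card_image_mul_right K s]
        exact_mod_cast card_sdiff_add_card_inter _ _
      have hins := hP.insert hs hsP (by rw [card_image_mul_right]; linarith)
      have := hPmax _ (mem_filter.2 ⟨mem_powerset.2 hins.1, hins⟩)
      rw [card_insert_of_notMem hsP] at this
      omega
  have hKpos : (0 : ℝ) < K.card := by exact_mod_cast hK.card_pos
  refine le_of_mul_le_mul_right ?_ hKpos
  calc ε * ((finInterior K Ω).card : ℝ) * K.card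
      = ∑ _s ∈ finInterior K Ω, ε * (K.card : ℝ) := by
        rw [sum_const, nsmul_eq_mul]; ring
    _ ≤ ∑ s ∈ finInterior K Ω, ((K.image (· * s) ∩ translates K P).card : ℝ) :=
        sum_le_sum hlarge
    _ ≤ (translates K P).card * K.card := by
        exact_mod_cast sum_card_image_mul_right_inter_le K _ _

theorem card_finBoundary_le_of_amenConst_le {A K : Finset S} (hA : A.Nonempty) {c : ℝ}
    (h : amenConst A K ≤ c) : ((finBoundary K A).card : ℝ) ≤ c * A.card :=
  (div_le_iff₀ (by exact_mod_cast hA.card_pos)).1 h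

theorem IsFillingPattern.card_finBoundary_translates_le [IsCancelMul S] {ε c : ℝ}
    (hε : ε ≤ 1 / 2) (hc : 0 ≤ c) {K L Ω P : Finset S} (hL : L.Nonempty)
    (h : IsFillingPattern ε L Ω P) (hLK : amenConst L K ≤ c) :
    ((finBoundary K (translates L P)).card : ℝ) ≤ 2 * c * (translates L P).card := by
  have hP := h.card_mul_card_le
  have hPL : (P.card : ℝ) * L.card ≤ 2 * (translates L P).card := by
    nlinarith [mul_nonneg (Nat.cast_nonneg (α := ℝ) P.card) (Nat.cast_nonneg (α := ℝ) L.card)]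
  calc ((finBoundary K (translates L P)).card : ℝ)
      ≤ ∑ s ∈ P, ((finBoundary K (L.image (· * s))).card : ℝ) := by
        exact_mod_cast card_finBoundary_biUnion_le K P fun s => L.image (· * s)
    _ ≤ ∑ _s ∈ P, c * (L.card : ℝ) := by
        refine sum_le_sum fun s _ => le_trans ?_ (card_finBoundary_le_of_amenConst_le hL hLK)
        exact_mod_cast card_finBoundary_image_mul_right_le K L s
    _ = c * ((P.card : ℝ) * L.card) := by rw [sum_const, nsmul_eq_mul]; ring
    _ ≤ c * (2 * (translates L P).card) := mul_le_mul_of_nonneg_left hPL hc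
    _ = 2 * c * (translates L P).card := by ring

/-- The conditions on a family of filling patterns other than the size of the remainder. -/
structure IsFillingFamily {ι : Type*} (ε : ℝ) (K : ι → Finset S) (D : Finset S)
    (P : ι → Finset S) : Prop where
  isFillingPattern : ∀ j, IsFillingPattern ε (K j) D (P j)
  pairwise_disjoint : Pairwise fun j k => Disjoint (translates (K j) (P j))
    (translates (K k) (P k))

namespace IsFillingFamily

variable {ι : Type*} [Fintype ι] {ε : ℝ} {K : ι → Finset S} {D : Finset S} {P : ι → Finset S}

/-- The boundary of the remainder is small if the boundary of `D` and of all the tiles used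
is. -/
theorem card_finBoundary_remainder_le [IsCancelMul S] (h : IsFillingFamily ε K D P)
    (hε : ε ≤ 1 / 2) {c : ℝ} (hc : 0 ≤ c) {L : Finset S} (hL : L.Nonempty) (hD : D.Nonempty)
    (hK : ∀ i, (K i).Nonempty) (hDL : amenConst D L ≤ c)
    (hKL : ∀ i, (P i).Nonempty → amenConst (K i) L ≤ c / L.card) :
    ((finBoundary L (D \ univ.biUnion fun i => translates (K i) (P i))).card : ℝ) ≤
      3 * c * D.card := by
  set A := univ.biUnion fun i => translates (K i) (P i) with hA
  have hLpos : (0 : ℝ) < L.card := by exact_mod_cast hL.card_pos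
  have hAD : (A.card : ℝ) ≤ D.card := by
    exact_mod_cast card_le_card
      (biUnion_subset.2 fun i _ => (h.isFillingPattern i).translates_subset)
  have hAcard : (A.card : ℝ) = ∑ i, ((translates (K i) (P i)).card : ℝ) := by
    rw [hA, card_biUnion fun i _ j _ hij => h.pairwise_disjoint hij, Nat.cast_sum]
  have hAL : ((finBoundary L A).card : ℝ) ≤ 2 * (c / L.card) * A.card := by
    calc ((finBoundary L A).card : ℝ)
        ≤ ∑ i, ((finBoundary L (translates (K i) (P i))).card : ℝ) := by
          exact_mod_cast card_finBoundary_biUnion_le L univ _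
      _ ≤ ∑ i, 2 * (c / L.card) * ((translates (K i) (P i)).card : ℝ) := by
          refine sum_le_sum fun i _ => ?_
          obtain hPi | hPi := (P i).eq_empty_or_nonempty
          · simp [hPi, finBoundary]
          · exact (h.isFillingPattern i).card_finBoundary_translates_le hε
              (div_nonneg hc hLpos.le) (hK i) (hKL i hPi)
      _ = 2 * (c / L.card) * A.card := by rw [hAcard, mul_sum]
  have hmul : (L.card : ℝ) * (finBoundary L A).card ≤ 2 * c * A.card := by
    calc (L.card : ℝ) * (finBoundary L A).card
        ≤ L.card * (2 * (c / L.card) * A.card) := mul_le_mul_of_nonneg_left hAL hLpos.le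
      _ = 2 * c * A.card := by field_simp
  calc ((finBoundary L (D \ A)).card : ℝ)
      ≤ (finBoundary L D).card + L.card * (finBoundary L A).card := by
        exact_mod_cast card_finBoundary_sdiff_le L D A
    _ ≤ c * D.card + 2 * c * A.card :=
        add_le_add (card_finBoundary_le_of_amenConst_le hD hDL) hmul
    _ ≤ c * D.card + 2 * c * D.card := by gcongr
    _ = 3 * c * D.card := by ring

/-- An empty pattern may be replaced by a pattern filling the remainder. -/
theorem update [DecidableEq ι] (h : IsFillingFamily ε K D P) {j : ι} {Q : Finset S}
    (hQ : IsFillingPattern ε (K j) (D \ univ.biUnion fun i => translates (K i) (P i)) Q) :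
    IsFillingFamily ε K D (Function.update P j Q) := by
  have hdisj : ∀ i, Disjoint (translates (K j) Q) (translates (K i) (P i)) := fun i =>
    disjoint_of_subset_left hQ.translates_subset (disjoint_of_subset_right
      (subset_biUnion_of_mem (fun i => translates (K i) (P i)) (mem_univ i)) sdiff_disjoint)
  refine ⟨fun i => ?_, fun i k hik => ?_⟩
  · obtain rfl | hij := eq_or_ne i j
    · rw [Function.update_self]
      exact hQ.mono sdiff_subset
    · rw [Function.update_of_ne hij]
      exact h.isFillingPattern i
  · obtain rfl | hij := eq_or_ne i j
    · rw [Function.update_self, Function.update_of_ne hik.symm]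
      exact hdisj k
    · rw [Function.update_of_ne hij]
      obtain rfl | hkj := eq_or_ne k j
      · rw [Function.update_self]
        exact (hdisj i).symm
      · rw [Function.update_of_ne hkj]
        exact h.pairwise_disjoint hik

theorem remainder_update_subset [DecidableEq ι] {j : ι} (hj : P j = ∅) (Q : Finset S) :
    (D \ univ.biUnion fun i => translates (K i) (Function.update P j Q i)) ⊆
      (D \ univ.biUnion fun i => translates (K i) (P i)) \ translates (K j) Q := by
  rw [sdiff_sdiff_left]
  refine sdiff_subset_sdiff subset_rfl (union_subset (biUnion_subset.2 fun i _ => ?_) ?_)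
  · obtain rfl | hij := eq_or_ne i j
    · simp [hj]
    · have := subset_biUnion_of_mem
        (fun i => translates (K i) (Function.update P j Q i)) (mem_univ i)
      rwa [Function.update_of_ne hij] at this
  · have := subset_biUnion_of_mem
      (fun i => translates (K i) (Function.update P j Q i)) (mem_univ j)
    rwa [Function.update_self] at this

end IsFillingFamily

/-- Using the `m` last tiles, either the remainder is already small or it shrinks
geometrically with `m`. -/
theorem exists_isFillingFamily [IsCancelMul S] {ε : ℝ} (hε₀ : 0 < ε) (hε₁ : ε ≤ 1 / 2) {c : ℝ}
    (hc₀ : 0 ≤ c) (hc : 6 * c ≤ ε) {n : ℕ} {K : Fin n → Finset S} (hK : ∀ j, (K j).Nonempty)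
    (hKK : ∀ j k, j < k → amenConst (K k) (K j) ≤ c / (K j).card) {D : Finset S}
    (hD : D.Nonempty) (hDK : ∀ j, amenConst D (K j) ≤ c) (m : ℕ) (hm : m ≤ n) :
    ∃ P : Fin n → Finset S, IsFillingFamily ε K D P ∧
      (∀ j : Fin n, (j : ℕ) + m < n → P j = ∅) ∧
      ((D \ univ.biUnion fun i => translates (K i) (P i)).card : ℝ) ≤
        max ε ((1 - ε / 2) ^ m) * D.card := by
  induction m with
  | zero =>
    refine ⟨fun _ => ∅, ⟨fun j => isFillingPattern_empty ε _ _, fun j k _ => by simp⟩,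
      fun _ _ => rfl, ?_⟩
    rw [pow_zero]
    exact (Nat.cast_le.2 (card_le_card sdiff_subset)).trans
      (le_mul_of_one_le_left (Nat.cast_nonneg _) (le_max_right _ _))
  | succ m ih =>
    obtain ⟨P, hP, hempty, hcard⟩ := ih (by omega)
    set R := D \ univ.biUnion fun i => translates (K i) (P i) with hR
    by_cases hsmall : (R.card : ℝ) ≤ ε * D.card
    · exact ⟨P, hP, fun j hj => hempty j (by omega),
        hsmall.trans (mul_le_mul_of_nonneg_right (le_max_left _ _) (Nat.cast_nonneg _))⟩
    push Not at hsmall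
    let j : Fin n := ⟨n - (m + 1), by omega⟩
    have hj : P j = ∅ := hempty j (by simp only [j]; omega)
    obtain ⟨Q, hQ, hQcard⟩ := exists_isFillingPattern (by linarith : ε ≤ 1) (hK j) R
    have hDpos : (0 : ℝ) < D.card := by exact_mod_cast hD.card_pos
    have hbd : ((finBoundary (K j) R).card : ℝ) ≤ 3 * c * D.card := by
      refine hP.card_finBoundary_remainder_le hε₁ hc₀ (hK j) hD hK (hDK j) fun i hi => ?_
      refine hKK j i ?_
      by_contra! hij
      rcases hij.lt_or_eq with hlt | rfl
      · have hlt' : (i : ℕ) < n - (m + 1) := hlt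
        simp [hempty i (by omega)] at hi
      · simp [hj] at hi
    have hint : ((finInterior (K j) R).card : ℝ) + (finBoundary (K j) R).card = R.card := by
      exact_mod_cast card_finInterior_add_card_finBoundary (K j) R
    have hhalf : (R.card : ℝ) / 2 ≤ (finInterior (K j) R).card := by nlinarith
    have hsub : ((R \ translates (K j) Q).card : ℝ) + (translates (K j) Q).card = R.card := by
      exact_mod_cast card_sdiff_add_card_eq_card hQ.translates_subset
    have hnew : ((R \ translates (K j) Q).card : ℝ) ≤ (1 - ε / 2) * R.card := by nlinarith
    refine ⟨Function.update P j Q, hP.update hQ, fun i hi => ?_, ?_⟩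
    · have hij : i ≠ j := by
        rintro rfl
        simp only [j] at hi
        omega
      rw [Function.update_of_ne hij]
      exact hempty i (by omega)
    · have hgeo : (R.card : ℝ) ≤ (1 - ε / 2) ^ m * D.card := by
        rcases le_total ε ((1 - ε / 2) ^ m) with hle | hle
        · rwa [max_eq_right hle] at hcard
        · rw [max_eq_left hle] at hcard
          exact absurd hcard hsmall.not_ge
      calc ((D \ univ.biUnion fun i => translates (K i) (Function.update P j Q i)).card : ℝ)
          ≤ (R \ translates (K j) Q).card := by
            exact_mod_cast card_le_card (IsFillingFamily.remainder_update_subset hj Q)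
        _ ≤ (1 - ε / 2) * R.card := hnew
        _ ≤ (1 - ε / 2) * ((1 - ε / 2) ^ m * D.card) :=
            mul_le_mul_of_nonneg_left hgeo (by linarith)
        _ = (1 - ε / 2) ^ (m + 1) * D.card := by ring
        _ ≤ max ε ((1 - ε / 2) ^ (m + 1)) * D.card :=
            mul_le_mul_of_nonneg_right (le_max_right _ _) (Nat.cast_nonneg _)

end Filling

/-- Theorem 3.8 (Filling theorem): let `S` be a cancellative semigroup and `0 < ε ≤ 1/2`.
There is `n₀ = n₀(ε) ≥ 1` such that for all `n ≥ n₀`, if `(K j)_{1 ≤ j ≤ n}` are nonempty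
finite subsets of `S` with `α(K k, K j) ≤ ε^{2n} / |K j|` for `j < k`, and `D` is a nonempty
finite subset of `S` with `α(D, K j) ≤ ε^{2n}` for all `j`, then there are finite subsets
`(P j)_{1 ≤ j ≤ n}` of `S` such that (T1) each `P j` is an `(ε, K j)`-filling pattern for
`D`; (T2) the subsets `K j • P j ⊆ D` are pairwise disjoint; (T3) the set
`D' = D \ ⋃_j K j • P j` satisfies `|D'| ≤ ε |D|`. -/
theorem filling_theorem {S : Type*} [Semigroup S] [IsCancelMul S] [DecidableEq S]
    (ε : ℝ) (hε₀ : 0 < ε) (hε₁ : ε ≤ 1 / 2) :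
    ∃ n₀ : ℕ, 1 ≤ n₀ ∧
      ∀ n : ℕ, n₀ ≤ n →
        ∀ K : Fin n → Finset S, (∀ j, (K j).Nonempty) →
          (∀ j k : Fin n, j < k →
            amenConst (K k) (K j) ≤ ε ^ (2 * n) / ((K j).card : ℝ)) →
          ∀ D : Finset S, D.Nonempty →
            (∀ j, amenConst D (K j) ≤ ε ^ (2 * n)) →
            ∃ P : Fin n → Finset S,
              (∀ j, IsFillingPattern ε (K j) D (P j)) ∧
              (∀ j, (P j).biUnion (fun s => (K j).image (· * s)) ⊆ D) ∧
              (Pairwise fun j k : Fin n =>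
                Disjoint ((P j).biUnion (fun s => (K j).image (· * s)))
                  ((P k).biUnion (fun s => (K k).image (· * s)))) ∧
              (((D \ Finset.univ.biUnion
                  (fun j => (P j).biUnion (fun s => (K j).image (· * s)))).card : ℝ) ≤
                ε * (D.card : ℝ)) := by
  obtain ⟨N, hN⟩ := exists_pow_lt_of_lt_one hε₀ (by linarith : 1 - ε / 2 < 1)
  refine ⟨max N 2, by omega, fun n hn K hK hKK D hD hDK => ?_⟩
  have hsmall : 6 * ε ^ (2 * n) ≤ ε := by
    have hpow : ε ^ (2 * n) ≤ ε ^ 4 :=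
      pow_le_pow_of_le_one hε₀.le (by linarith) (by omega)
    have hcube : ε ^ 3 ≤ (1 / 2) ^ 3 := pow_le_pow_left₀ hε₀.le hε₁ 3
    nlinarith
  have hgeo : (1 - ε / 2) ^ n ≤ ε :=
    (pow_le_pow_of_le_one (by linarith) (by linarith) (by omega)).trans hN.le
  obtain ⟨P, hP, -, hcard⟩ := exists_isFillingFamily hε₀ hε₁ (by positivity) hsmall hK hKK hD
    hDK n le_rfl
  rw [max_eq_left hgeo] at hcard
  exact ⟨P, hP.isFillingPattern, fun j => (hP.isFillingPattern j).translates_subset,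
    hP.pairwise_disjoint, hcard⟩
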